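/- (F-Mixing Criterion) Let T : X → X be an operator and F a Furstenberg family. Suppose there exist dense subsets X₀, Y₀ of X and a sequence of maps S_n : Y₀ → X (n ∈ ℕ) such that for every x₀ ∈ X₀ and y₀ ∈ Y₀ one has F-lim_{n→∞} (T^n x₀, S_n y₀, T^n S_n y₀) = (0, 0, y₀), meaning that for every neighborhood O of (0,0,y₀) in X × X × X the set {n ∈ ℕ : (T^n x₀, S_n y₀, T^n S_n y₀) ∈ O} belongs to F. Then T is F-mixing. -/

import Mathlib

open Set Topology Function Filter
open scoped ENNReal

/- ### Basic dynamical notions -/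

/-- The return time set `N(U,V) = {n ∈ ℕ : T^n(U) ∩ V ≠ ∅}`. -/
def nset {X : Type*} (T : X → X) (U V : Set X) : Set ℕ :=
  {n : ℕ | ∃ x ∈ U, T^[n] x ∈ V}

/-- A Furstenberg family: nonempty, hereditary upward, not containing `∅`. -/
def IsFamily (F : Set (Set ℕ)) : Prop :=
  F.Nonempty ∧ (∀ ⦃A B : Set ℕ⦄, A ∈ F → A ⊆ B → B ∈ F) ∧ ∅ ∉ F

/-- `T` is `F`-transitive. -/
def FTrans {X : Type*} [TopologicalSpace X] (T : X → X) (F : Set (Set ℕ)) : Prop :=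
  ∀ U V : Set X, IsOpen U → IsOpen V → U.Nonempty → V.Nonempty → nset T U V ∈ F

/-- Direct sum (product) of two maps. -/
def prodMap' {X Y : Type*} (T : X → X) (S : Y → Y) : X × Y → X × Y :=
  fun p => (T p.1, S p.2)

/-- `T` is `F`-mixing: `T × T` is `F`-transitive. -/
def FMix {X : Type*} [TopologicalSpace X] (T : X → X) (F : Set (Set ℕ)) : Prop :=
  FTrans (prodMap' T T) F

/-- Topological transitivity. -/
def TopTrans {X : Type*} [TopologicalSpace X] (T : X → X) : Prop :=
  ∀ U V : Set X, IsOpen U → IsOpen V → U.Nonempty → V.Nonempty → (nset T U V).Nonempty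

/-- Weak mixing: `T × T` is topologically transitive. -/
def WMix {X : Type*} [TopologicalSpace X] (T : X → X) : Prop :=
  TopTrans (prodMap' T T)

/-- Hypercyclicity: some point has dense orbit. -/
def HypercyclicMap {X : Type*} [TopologicalSpace X] (T : X → X) : Prop :=
  ∃ x : X, Dense (Set.range fun n : ℕ => T^[n] x)

/-- Weak disjointness: the direct sum is hypercyclic. -/
def WeaklyDisjoint {X Y : Type*} [TopologicalSpace X] [TopologicalSpace Y]
    (T : X → X) (S : Y → Y) : Prop :=
  HypercyclicMap (prodMap' T S)

/-- The family generated by the return time sets of `T`. -/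
def NTfam {X : Type*} [TopologicalSpace X] (T : X → X) : Set (Set ℕ) :=
  {A : Set ℕ | ∃ U V : Set X, IsOpen U ∧ IsOpen V ∧ U.Nonempty ∧ V.Nonempty ∧ nset T U V ⊆ A}

/- ### Combinatorial families -/

/-- `(A + i) ∩ ℕ` for `i : ℤ`. -/
def shiftSet (A : Set ℕ) (i : ℤ) : Set ℕ := {n : ℕ | ∃ m ∈ A, (n : ℤ) = (m : ℤ) + i}

/-- A shift-invariant family. -/
def ShiftInvariant (F : Set (Set ℕ)) : Prop := ∀ A ∈ F, ∀ i : ℤ, shiftSet A i ∈ F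

/-- A shift₊-invariant family: `A + i ∈ F` for `i : ℕ`. -/
def ShiftPlusInvariant (F : Set (Set ℕ)) : Prop :=
  ∀ A ∈ F, ∀ i : ℕ, (fun n => n + i) '' A ∈ F

/-- A thick family: `⋂_{i=0}^{k} ((A - i) ∩ ℕ) ∈ F` for all `A ∈ F`, `k ∈ ℕ`. -/
def ThickFamily (F : Set (Set ℕ)) : Prop :=
  ∀ A ∈ F, ∀ k : ℕ, {n : ℕ | ∀ i ≤ k, n + i ∈ A} ∈ F

/-- The dual family `F*`. -/
def dualFam (F : Set (Set ℕ)) : Set (Set ℕ) := {A | ∀ B ∈ F, (A ∩ B).Nonempty}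

/-- A full family. -/
def FullFamily (F : Set (Set ℕ)) : Prop :=
  ∀ A ∈ F, ∀ B ∈ dualFam F, (A ∩ B).Infinite

/-- `F̃`: the members `A` of `F` with `⋂_{i=-k}^{k} ((A + i) ∩ ℕ) ∈ F` for all `k ∈ ℕ`. -/
def tildeFam (F : Set (Set ℕ)) : Set (Set ℕ) :=
  {A ∈ F | ∀ k : ℕ, {n : ℕ | ∀ i : ℤ, |i| ≤ (k : ℤ) → n ∈ shiftSet A i} ∈ F}

/-- A thick subset of `ℕ`: contains arbitrarily long blocks of consecutive integers. -/
def IsThickSet (A : Set ℕ) : Prop := ∀ k : ℕ, ∃ n : ℕ, ∀ i ≤ k, n + i ∈ A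

/-- A syndetic subset of `ℕ` (bounded gaps). -/
def IsSyndetic (A : Set ℕ) : Prop := ∃ g : ℕ, ∀ n : ℕ, ∃ m ∈ A, n ≤ m ∧ m ≤ n + g

/-- A piecewise syndetic subset: intersection of a syndetic and a thick set. -/
def IsPiecewiseSyndetic (A : Set ℕ) : Prop :=
  ∃ S T : Set ℕ, IsSyndetic S ∧ IsThickSet T ∧ A = S ∩ T

/-- An IP-set. -/
def IsIPSet (A : Set ℕ) : Prop :=
  ∃ x : ℕ → ℕ, {n | x n ≠ 0}.Infinite ∧ ∀ s : Finset ℕ, s.Nonempty → (∑ i ∈ s, x i) ∈ A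

/-- `(A - A) ∩ ℕ` for `A ⊆ ℕ`: positive differences of distinct elements. -/
def diffSet (A : Set ℕ) : Set ℕ := {k | ∃ m ∈ A, ∃ n ∈ A, n < m ∧ k = m - n}

/-- The family `Δ*_ip`. -/
def deltaIPStar : Set (Set ℕ) :=
  {A | ∀ F : Set ℕ, IsIPSet F → (A ∩ diffSet F).Nonempty}

/- ### Operators on Fréchet spaces -/

/-- A (continuous linear) operator on an infinite-dimensional separable Fréchet space
(a complete metrizable locally convex topological vector space) over `ℝ` or `ℂ`
(an `RCLike` field). -/
structure FrechetOp where
  𝕜 : Type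
  [instField : RCLike 𝕜]
  X : Type
  [instAdd : AddCommGroup X]
  [instMod : Module 𝕜 X]
  [instUnif : UniformSpace X]
  [instUAG : IsUniformAddGroup X]
  [instSMul : ContinuousSMul 𝕜 X]
  [instComplete : CompleteSpace X]
  [instMetrizable : TopologicalSpace.MetrizableSpace X]
  [instSeparable : TopologicalSpace.SeparableSpace X]
  [instModR : Module ℝ X]
  [instTower : IsScalarTower ℝ 𝕜 X]
  [instLC : LocallyConvexSpace ℝ X]
  infDim : ¬ FiniteDimensional 𝕜 X
  T : X → X
  linear : IsLinearMap 𝕜 T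
  cont : Continuous T

attribute [instance] FrechetOp.instAdd FrechetOp.instMod
  FrechetOp.instUnif FrechetOp.instUAG FrechetOp.instSMul FrechetOp.instComplete
  FrechetOp.instMetrizable FrechetOp.instSeparable FrechetOp.instModR
  FrechetOp.instTower FrechetOp.instLC

/-- A bundled Fréchet-space operator is hypercyclic. -/
def FrechetOp.Hypercyclic (S : FrechetOp) : Prop := HypercyclicMap S.T

/-- A bundled Fréchet-space operator is invertible (a linear homeomorphism). -/
def FrechetOp.Invertible (S : FrechetOp) : Prop :=
  ∃ T' : S.X → S.X, Continuous T' ∧ (∀ x, T' (S.T x) = x) ∧ (∀ x, S.T (T' x) = x)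

/-- Mild mixing: weakly disjoint from every hypercyclic operator
(on every infinite-dimensional separable Fréchet space). -/
def MildlyMixing {X : Type*} [TopologicalSpace X] (T : X → X) : Prop :=
  ∀ S : FrechetOp, S.Hypercyclic → WeaklyDisjoint T S.T

/-- Topological ergodicity: all return time sets are syndetic. -/
def TopErgodic {X : Type*} [TopologicalSpace X] (T : X → X) : Prop :=
  ∀ U V : Set X, IsOpen U → IsOpen V → U.Nonempty → V.Nonempty → IsSyndetic (nset T U V)

/-- The `F`-Mixing Criterion for a map `T`. -/
def FMixCriterion {X : Type*} [TopologicalSpace X] [Zero X] (T : X → X)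
    (F : Set (Set ℕ)) : Prop :=
  ∃ X₀ Y₀ : Set X, Dense X₀ ∧ Dense Y₀ ∧ ∃ S : ℕ → X → X,
    ∀ x₀ ∈ X₀, ∀ y₀ ∈ Y₀, ∀ O ∈ nhds ((0, 0, y₀) : X × X × X),
      {n : ℕ | (T^[n] x₀, S n y₀, T^[n] (S n y₀)) ∈ O} ∈ F

/- ### Bilateral weighted backward shifts on `ℓᵖ(ℤ)` and `c₀(ℤ)` -/

/-- `B` is the bilateral weighted backward shift with (positive, bounded) weight `w` on
`ℓᵖ(ℤ)`; the condition that `1/w` is bounded makes it invertible. -/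
def IsInvertibleWBSlp (𝕜 : Type) [RCLike 𝕜] (p : ℝ≥0∞) [Fact (1 ≤ p)] (w : ℤ → ℝ)
    (B : lp (fun _ : ℤ => 𝕜) p →L[𝕜] lp (fun _ : ℤ => 𝕜) p) : Prop :=
  (∀ n, 0 < w n) ∧ (∃ C : ℝ, ∀ n, w n ≤ C) ∧ (∃ c : ℝ, 0 < c ∧ ∀ n, c ≤ w n) ∧
    ∀ (x : lp (fun _ : ℤ => 𝕜) p) (n : ℤ), B x n = w (n + 1) • x (n + 1)

/-- `B` is the bilateral weighted backward shift with (positive, bounded) weight `w` on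
`c₀(ℤ)`; the condition that `1/w` is bounded makes it invertible. -/
def IsInvertibleWBSc0 (𝕜 : Type) [RCLike 𝕜] (w : ℤ → ℝ)
    (B : ZeroAtInftyContinuousMap ℤ 𝕜 →L[𝕜] ZeroAtInftyContinuousMap ℤ 𝕜) : Prop :=
  (∀ n, 0 < w n) ∧ (∃ C : ℝ, ∀ n, w n ≤ C) ∧ (∃ c : ℝ, 0 < c ∧ ∀ n, c ≤ w n) ∧
    ∀ (x : ZeroAtInftyContinuousMap ℤ 𝕜) (n : ℤ), B x n = w (n + 1) • x (n + 1)
theorem prodMap'_iterate {X : Type*} (T : X → X) (n : ℕ) (p : X × X) :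
    (prodMap' T T)^[n] p = (T^[n] p.1, T^[n] p.2) := by
  induction n generalizing p with
  | zero => rfl
  | succ k ih => rw [Function.iterate_succ_apply, ih]; rfl

/-- **`F`-Mixing Criterion.** If there are dense subsets `X₀, Y₀ ⊆ X` and
maps `Sₙ : Y₀ → X` such that `F-lim (Tⁿx₀, Sₙy₀, TⁿSₙy₀) = (0,0,y₀)` for all `x₀ ∈ X₀`,
`y₀ ∈ Y₀`, then `T` is `F`-mixing. -/
theorem fMixing_of_criterion
    (F : Set (Set ℕ)) (hF : IsFamily F) (T : FrechetOp)
    (h : FMixCriterion T.T F) : FMix T.T F := by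
  obtain ⟨X₀, Y₀, hX, hY, S, hS⟩ := h
  letI := T.instField
  obtain ⟨-, hup, hemp⟩ := hF
  have hadd : ∀ (n : ℕ) (x y : T.X), T.T^[n] (x + y) = T.T^[n] x + T.T^[n] y := by
    intro n
    induction n with
    | zero => intro x y; rfl
    | succ k ih => intro x y; simp only [Function.iterate_succ_apply, T.linear.map_add, ih]
  have hzero : ∀ n : ℕ, T.T^[n] (0 : T.X) = 0 := by
    intro n
    have := hadd n 0 0
    simpa using this
  have hc : ∀ n : ℕ, Continuous (T.T^[n]) := fun n => T.cont.iterate n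
  have hcomm : ∀ (n m : ℕ) (x : T.X), T.T^[n] (T.T^[m] x) = T.T^[m] (T.T^[n] x) := by
    intro n m x
    rw [← Function.iterate_add_apply, ← Function.iterate_add_apply, add_comm]
  -- transitivity
  have htrans : ∀ U V : Set T.X, IsOpen U → IsOpen V → U.Nonempty → V.Nonempty →
      ∃ n : ℕ, (U ∩ T.T^[n] ⁻¹' V).Nonempty := by
    intro U V hU hV hUn hVn
    obtain ⟨x, hxU, hx⟩ := hX.inter_open_nonempty U hU hUn
    obtain ⟨y, hyV, hy⟩ := hY.inter_open_nonempty V hV hVn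
    have hO : {p : T.X × T.X × T.X | x + p.2.1 ∈ U ∧ p.1 + p.2.2 ∈ V} ∈
        nhds ((0, 0, y) : T.X × T.X × T.X) := by
      refine IsOpen.mem_nhds ?_ (by simpa using ⟨hxU, hyV⟩)
      exact (hU.preimage (by fun_prop : Continuous fun p : T.X × T.X × T.X => x + p.2.1)).inter
        (hV.preimage (by fun_prop : Continuous fun p : T.X × T.X × T.X => p.1 + p.2.2))
    have hmem := hS x hx y hy _ hO
    obtain ⟨n, hn⟩ : Set.Nonempty _ :=
      Set.nonempty_iff_ne_empty.2 (fun h0 => hemp (h0 ▸ hmem))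
    refine ⟨n, x + S n y, hn.1, ?_⟩
    rw [Set.mem_preimage, hadd]
    exact hn.2
  intro U V hU hV ⟨u, hu⟩ ⟨v, hv⟩
  obtain ⟨U1, U2, hU1, hU2, hu1, hu2, hUs⟩ := isOpen_prod_iff.1 hU u.1 u.2 hu
  obtain ⟨V1, V2, hV1, hV2, hv1, hv2, hVs⟩ := isOpen_prod_iff.1 hV v.1 v.2 hv
  obtain ⟨m, hm⟩ := htrans U1 U2 hU1 hU2 ⟨_, hu1⟩ ⟨_, hu2⟩
  obtain ⟨l, hl⟩ := htrans V1 V2 hV1 hV2 ⟨_, hv1⟩ ⟨_, hv2⟩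
  obtain ⟨x, ⟨hxU1, hxU2⟩, hx⟩ :=
    hX.inter_open_nonempty _ (hU1.inter (hU2.preimage (hc m))) hm
  obtain ⟨y, ⟨hyV1, hyV2⟩, hy⟩ :=
    hY.inter_open_nonempty _ (hV1.inter (hV2.preimage (hc l))) hl
  have hcm := hc m
  have hcl := hc l
  have hO : {p : T.X × T.X × T.X | (x + p.2.1, T.T^[m] x + T.T^[l] p.2.1) ∈ U1 ×ˢ U2 ∧
      (p.1 + p.2.2, T.T^[m] p.1 + T.T^[l] p.2.2) ∈ V1 ×ˢ V2} ∈
      nhds ((0, 0, y) : T.X × T.X × T.X) := by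
    refine IsOpen.mem_nhds ?_ ?_
    · exact ((hU1.prod hU2).preimage (by fun_prop : Continuous fun p : T.X × T.X × T.X =>
          (x + p.2.1, T.T^[m] x + T.T^[l] p.2.1))).inter
        ((hV1.prod hV2).preimage (by fun_prop : Continuous fun p : T.X × T.X × T.X =>
          (p.1 + p.2.2, T.T^[m] p.1 + T.T^[l] p.2.2)))
    · simp only [Set.mem_ofPred_eq, Set.mem_prod, hzero, add_zero, zero_add]
      exact ⟨⟨hxU1, hxU2⟩, hyV1, hyV2⟩
  refine hup (hS x hx y hy _ hO) ?_
  intro n hn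
  refine ⟨(x + S n y, T.T^[m] x + T.T^[l] (S n y)), hUs hn.1, ?_⟩
  rw [prodMap'_iterate]
  simp only [hadd]
  rw [hcomm n m, hcomm n l]
  exact hVs hn.2
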